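/- With ker Bᵀ = 0, dim(ker A/range Bᵀ) = 1, and A surjective as the three assertions: the three-term complex ℚ⁷ →(Bᵀ) ℚ¹⁴ →(A) ℚ⁶ built from the matrices A and B as defined has vanishing homology at ℚ⁷ (i.e. Bᵀ is injective), one-dimensional homology at ℚ¹⁴ (i.e. range(Bᵀ) ⊆ ker(A) and ker(A)/range(Bᵀ) has ℚ-dimension 1), and vanishing homology at ℚ⁶ (i.e. A is surjective). -/

import Mathlib

/-- The second Feynman transform differential (edge degree 1 → 2) of the S₄-coinvariants
of the internal-degree-(-4) summand of FT(H_*(M̄))(1,4), in the basis λ₁,…,λ₁₄. -/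
def A : Matrix (Fin 6) (Fin 14) ℚ :=
  !![0, 0, 0, 0, 0, 1, 0, 0, -1, 0, 0, 0, 0, 0;
     1, 0, 0, 0, -1, 0, 0, 0, 0, 0, 0, 0, 0, 0;
     0, 1, 0, 0, 0, 0, -1, 0, 0, 0, 0, 0, 0, 0;
     0, 0, -1, 0, 0, 0, 0, 0, 0, 0, 1, 0, 0, 0;
     0, 0, 0, -1, 0, 0, 0, 0, 0, 0, 0, 1, 0, 0;
     0, 0, 0, 0, 0, 0, 0, -1, 0, 0, 0, 0, 1, 0]

/-- The transpose of the first Feynman transform differential (edge degree 0 → 1). -/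
def B : Matrix (Fin 7) (Fin 14) ℚ :=
  !![0, 0, 0, 0, 0, 0, 0, 0, 0, 2, 0, 0, 0, 6;
     0, 0, 0, 0, 0, 1, 0, 0, 1, 0, 0, 0, 0, -2;
     1, 0, 0, 0, 1, 0, 0, 0, 0, 0, 0, 0, 0, 3;
     0, 1, 0, 0, 0, 0, 1, 0, 0, 0, 0, 0, 0, -1;
     0, 0, 1, 0, 0, 0, 0, 0, 0, 0, 1, 0, 0, 1/2;
     0, 0, 0, 1, 0, 0, 0, 0, 0, 0, 0, 1, 0, 1/2;
     0, 0, 0, 0, 0, 0, 0, 1, 0, 0, 0, 0, 1, 0]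

/-- The linear functional `|·|/e` of Lemma 4.4. -/
def ell (r : Fin 14 → ℚ) : ℚ :=
  -6 * r 0 + 2 * r 1 - r 2 - r 3 + 4 * r 5 - 6 * r 9 + 2 * r 13

/-- The coefficients `tᵢ` defining the map `f̄^ω : λᵢ ↦ tᵢ ω`. -/
def t (e : ℚ) : Fin 14 → ℚ :=
  ![-3 * e, e, -e / 2, -e / 2, -3 * e, 2 * e, e, 0, 2 * e, -6 * e, -e / 2, -e / 2, 0, 2 * e]

theorem aux_inj : Function.Injective (Matrix.mulVecLin B.transpose) := by
  rw [injective_iff_map_eq_zero]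
  intro v hv
  have h (i : Fin 14) : (Matrix.mulVecLin B.transpose v) i = 0 := by rw [hv]; rfl
  have h0 := h 0
  have h1 := h 1
  have h2 := h 2
  have h3 := h 3
  have h5 := h 5
  have h7 := h 7
  have h9 := h 9
  simp [B, Matrix.mulVec, dotProduct, Fin.sum_univ_succ] at h0 h1 h2 h3 h5 h7 h9
  ext i
  fin_cases i <;> simp <;> assumption

theorem aux_surj : Function.Surjective (Matrix.mulVecLin A) := by
  intro w
  refine ⟨![w 1, w 2, -w 3, -w 4, 0, w 0, 0, -w 5, 0, 0, 0, 0, 0, 0], ?_⟩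
  ext i
  fin_cases i <;> simp [A, Matrix.mulVec, dotProduct, Fin.sum_univ_succ]

theorem aux_mul : A * B.transpose = 0 := by
  ext i j
  fin_cases i <;> fin_cases j <;>
    simp [A, B, Matrix.mul_apply, Fin.sum_univ_succ]

theorem aux_le : LinearMap.range (Matrix.mulVecLin B.transpose) ≤
    LinearMap.ker (Matrix.mulVecLin A) := by
  rw [LinearMap.range_le_ker_iff, ← Matrix.mulVecLin_mul, aux_mul, Matrix.mulVecLin_zero]

/-- the three-term complex ℚ⁷ → ℚ¹⁴ → ℚ⁶ has vanishing homology at ℚ⁷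
(Bᵀ injective), one-dimensional homology at ℚ¹⁴, and vanishing homology at ℚ⁶
(A surjective). -/
theorem stmt_12 :
    Function.Injective (Matrix.mulVecLin B.transpose) ∧
    (LinearMap.range (Matrix.mulVecLin B.transpose) ≤ LinearMap.ker (Matrix.mulVecLin A) ∧
      Module.finrank ℚ
        ((LinearMap.ker (Matrix.mulVecLin A)) ⧸
          (LinearMap.range (Matrix.mulVecLin B.transpose)).comap
            (LinearMap.ker (Matrix.mulVecLin A)).subtype) = 1) ∧
    Function.Surjective (Matrix.mulVecLin A) := by
  refine ⟨aux_inj, ⟨aux_le, ?_⟩, aux_surj⟩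
  have h1 := LinearMap.finrank_range_add_finrank_ker (Matrix.mulVecLin A)
  rw [LinearMap.range_eq_top.2 aux_surj, finrank_top] at h1
  have h2 := LinearMap.finrank_range_of_inj aux_inj
  have h3 := Submodule.finrank_quotient_add_finrank
    ((LinearMap.range (Matrix.mulVecLin B.transpose)).comap
            (LinearMap.ker (Matrix.mulVecLin A)).subtype)
  have h4 := (Submodule.comapSubtypeEquivOfLe aux_le).finrank_eq
  rw [h4, h2] at h3
  simp only [Module.finrank_fin_fun] at h1 h3
  omega
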